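/- Let γ_k : ℝ → ℝ² be a periodic C¹ solution of X_T whose image is the circle C_k, with least period T*_k. Then ∫₀^{T*_k} div X_T(γ_k(t)) dt = (−1)^{N_k} · 4π s_k / τ_k, where N_k := #{ j ≠ k : C_k ⊆ D_{C_j} } and s_k := #{ j ∈ {1,…,r} : C_j ⊆ D_{C_k} } is the number of primary circles contained in the closed disc D_{C_k}. -/

import Mathlib

open MvPolynomial Function Set Filter Real
open scoped Classical

noncomputable section

/-- Bivariate real polynomials, representing components of planar polynomial vector fields. -/
abbrev Poly2 := MvPolynomial (Fin 2) ℝ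

/-- Evaluation of a bivariate polynomial at a point of the plane. -/
def pev (P : Poly2) (p : ℝ × ℝ) : ℝ := MvPolynomial.eval ![p.1, p.2] P

/-- The circle polynomial `f(x,y) = (x−a)² + (y−b)² − ρ²`. -/
def fpoly (c : ℝ × ℝ) (ρ : ℝ) : Poly2 :=
  (X 0 - MvPolynomial.C c.1) ^ 2 + (X 1 - MvPolynomial.C c.2) ^ 2 - MvPolynomial.C (ρ ^ 2)

/-- The divergence `∂P/∂x + ∂Q/∂y` of the vector field `X = P ∂ₓ + Q ∂ᵧ`. -/
def divPoly (P Q : Poly2) : Poly2 := pderiv 0 P + pderiv 1 Q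

/-- `γ : ℝ → ℝ²` is a (C¹) solution of the vector field `X = P ∂ₓ + Q ∂ᵧ`. -/
def IsSolution (P Q : Poly2) (γ : ℝ → ℝ × ℝ) : Prop :=
  ∀ t, HasDerivAt γ (pev P (γ t), pev Q (γ t)) t

/-- `S` is a periodic orbit of `X = P ∂ₓ + Q ∂ᵧ`: the image of a nonconstant periodic solution. -/
def IsPeriodicOrbit (P Q : Poly2) (S : Set (ℝ × ℝ)) : Prop :=
  ∃ γ : ℝ → ℝ × ℝ, ∃ T : ℝ, 0 < T ∧ IsSolution P Q γ ∧ Function.Periodic γ T ∧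
    (∃ t₀ t₁, γ t₀ ≠ γ t₁) ∧ Set.range γ = S

/-- `S` is a limit cycle: a periodic orbit with a neighborhood meeting no other periodic orbit. -/
def IsLimitCycle (P Q : Poly2) (S : Set (ℝ × ℝ)) : Prop :=
  IsPeriodicOrbit P Q S ∧
  ∃ U : Set (ℝ × ℝ), IsOpen U ∧ S ⊆ U ∧
    ∀ S', IsPeriodicOrbit P Q S' → S' ≠ S → Disjoint S' U

/-- `T` is the least positive period of `γ`. -/
def IsLeastPeriod (γ : ℝ → ℝ × ℝ) (T : ℝ) : Prop :=
  0 < T ∧ Function.Periodic γ T ∧ ∀ T', 0 < T' → Function.Periodic γ T' → T ≤ T'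

/-- The (limit) cycle `S` has least period `T`: it is parametrized by a solution of least
period `T`. -/
def HasLeastPeriodCycle (P Q : Poly2) (S : Set (ℝ × ℝ)) (T : ℝ) : Prop :=
  ∃ γ : ℝ → ℝ × ℝ, IsSolution P Q γ ∧ Set.range γ = S ∧ IsLeastPeriod γ T

/-- `V` is a (polynomial) inverse integrating factor of `X = P ∂ₓ + Q ∂ᵧ`:
`P ∂V/∂x + Q ∂V/∂y = V (∂P/∂x + ∂Q/∂y)`. -/
def IsInvFactor (P Q V : Poly2) : Prop :=
  P * pderiv 0 V + Q * pderiv 1 V = V * divPoly P Q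

/-- An embedded closed curve in the plane: a set homeomorphic to the circle. -/
def IsCycle (S : Set (ℝ × ℝ)) : Prop :=
  Nonempty (S ≃ₜ Metric.sphere (0 : ℝ × ℝ) 1)

/-- The compact region `D_C` bounded by a closed curve `C`: the curve together with the
points of the complement whose connected component in the complement is bounded. -/
def encDisk (S : Set (ℝ × ℝ)) : Set (ℝ × ℝ) :=
  S ∪ {p | p ∉ S ∧ Bornology.IsBounded (connectedComponentIn Sᶜ p)}

/-- `C_k` is a primary cycle of the configuration `Γ`: no other `C_j` is contained in `D_{C_k}`. -/
def PrimaryCycle {n : ℕ} (Γ : Fin n → Set (ℝ × ℝ)) (k : Fin n) : Prop :=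
  ∀ j, j ≠ k → ¬ Γ j ⊆ encDisk (Γ k)

/-- The limit cycle `S`, with enclosed region `D`, is stable in the interior for
`X = P ∂ₓ + Q ∂ᵧ`: every solution starting in the bounded region enclosed by `S`
sufficiently close to `S` converges to `S` as `t → +∞`. -/
def InteriorStable (P Q : Poly2) (S D : Set (ℝ × ℝ)) : Prop :=
  ∃ U : Set (ℝ × ℝ), IsOpen U ∧ S ⊆ U ∧
    ∀ γ : ℝ → ℝ × ℝ, IsSolution P Q γ → γ 0 ∈ (D \ S) ∩ U →
      Filter.Tendsto (fun t => Metric.infDist (γ t) S) Filter.atTop (nhds 0)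

/-- The limit cycle `S`, with enclosed region `D`, is unstable in the interior:
every solution starting in the bounded region enclosed by `S` sufficiently close to `S`
converges to `S` as `t → −∞`. -/
def InteriorUnstable (P Q : Poly2) (S D : Set (ℝ × ℝ)) : Prop :=
  ∃ U : Set (ℝ × ℝ), IsOpen U ∧ S ⊆ U ∧
    ∀ γ : ℝ → ℝ × ℝ, IsSolution P Q γ → γ 0 ∈ (D \ S) ∩ U →
      Filter.Tendsto (fun t => Metric.infDist (γ t) S) Filter.atBot (nhds 0)

/-- The polynomial `g(x,y) = (x−a)² + (y−b)²`. -/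
def gpoly (c : ℝ × ℝ) : Poly2 :=
  (X 0 - MvPolynomial.C c.1) ^ 2 + (X 1 - MvPolynomial.C c.2) ^ 2

variable {n : ℕ}

/-- `f_k(x,y) = (x−x_k)² + (y−y_k)² − r_k²`. -/
def fk (ctr : Fin n → ℝ × ℝ) (rad : Fin n → ℝ) (k : Fin n) : Poly2 :=
  fpoly (ctr k) (rad k)

/-- The circle `C_k = f_k⁻¹(0)`. -/
def Ccir (ctr : Fin n → ℝ × ℝ) (rad : Fin n → ℝ) (k : Fin n) : Set (ℝ × ℝ) :=
  {p : ℝ × ℝ | pev (fk ctr rad k) p = 0}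

/-- The closed disc `D_{C_k}` bounded by the circle `C_k`. -/
def Ddisc (ctr : Fin n → ℝ × ℝ) (rad : Fin n → ℝ) (k : Fin n) : Set (ℝ × ℝ) :=
  {p : ℝ × ℝ | (p.1 - (ctr k).1) ^ 2 + (p.2 - (ctr k).2) ^ 2 ≤ (rad k) ^ 2}

/-- `C_k` is primary: no other circle `C_j` is contained in `D_{C_k}`. -/
def Primary (ctr : Fin n → ℝ × ℝ) (rad : Fin n → ℝ) (k : Fin n) : Prop :=
  ∀ j, j ≠ k → ¬ Ccir ctr rad j ⊆ Ddisc ctr rad k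

/-- `A = ∏_{k=1}^n f_k`. -/
def Apoly (ctr : Fin n → ℝ × ℝ) (rad : Fin n → ℝ) : Poly2 := ∏ k, fk ctr rad k

/-- `B = ∏_{k=1}^r g_k` (product over the primary indices, i.e. those with `k < r`). -/
def Bpoly (r : ℕ) (ctr : Fin n → ℝ × ℝ) : Poly2 :=
  ∏ k ∈ Finset.univ.filter (fun k : Fin n => (k : ℕ) < r), gpoly (ctr k)

/-- `μ_k = ∏_{j≠k} f_j`. -/
def muk (ctr : Fin n → ℝ × ℝ) (rad : Fin n → ℝ) (k : Fin n) : Poly2 :=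
  ∏ j ∈ Finset.univ.erase k, fk ctr rad j

/-- `P_T = A(∂B/∂x − ∂B/∂y) − B Σ_k τ_k μ_k ∂f_k/∂y`. -/
def PT (r : ℕ) (ctr : Fin n → ℝ × ℝ) (rad τ : Fin n → ℝ) : Poly2 :=
  Apoly ctr rad * (pderiv 0 (Bpoly r ctr) - pderiv 1 (Bpoly r ctr)) -
    Bpoly r ctr * ∑ k, MvPolynomial.C (τ k) * muk ctr rad k * pderiv 1 (fk ctr rad k)

/-- `Q_T = A(∂B/∂x + ∂B/∂y) + B Σ_k τ_k μ_k ∂f_k/∂x`. -/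
def QT (r : ℕ) (ctr : Fin n → ℝ × ℝ) (rad τ : Fin n → ℝ) : Poly2 :=
  Apoly ctr rad * (pderiv 0 (Bpoly r ctr) + pderiv 1 (Bpoly r ctr)) +
    Bpoly r ctr * ∑ k, MvPolynomial.C (τ k) * muk ctr rad k * pderiv 0 (fk ctr rad k)

/-- `N_k`: the number of circles `C_j`, `j ≠ k`, whose bounded disc contains `C_k`. -/
def Nk (ctr : Fin n → ℝ × ℝ) (rad : Fin n → ℝ) (k : Fin n) : ℕ :=
  Nat.card {j : Fin n // j ≠ k ∧ Ccir ctr rad k ⊆ Ddisc ctr rad j}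

/-- `s_k`: the number of primary circles contained in the closed disc `D_{C_k}`. -/
def sk (r : ℕ) (ctr : Fin n → ℝ × ℝ) (rad : Fin n → ℝ) (k : Fin n) : ℕ :=
  Nat.card {j : Fin n // (j : ℕ) < r ∧ Ccir ctr rad j ⊆ Ddisc ctr rad k}

lemma eq_of_hasDerivAt_zero {f : ℝ → ℝ} (h : ∀ t, HasDerivAt f 0 t) (a b : ℝ) : f a = f b :=
  is_const_of_deriv_eq_zero (fun t => (h t).differentiableAt) (fun t => (h t).deriv) a b

lemma exists_angle_of_sq_add_sq {x y ρ : ℝ} (hρ : 0 < ρ) (h : x ^ 2 + y ^ 2 = ρ ^ 2) :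
    ∃ θ, x = ρ * cos θ ∧ y = ρ * sin θ := by
  set z : ℂ := ⟨x, y⟩ with hz
  have hnorm : ‖z‖ = ρ := by
    rw [Complex.norm_eq_sqrt_sq_add_sq, hz, h, Real.sqrt_sq hρ.le]
  refine ⟨z.arg, ?_, ?_⟩
  · rw [← hnorm, Complex.norm_mul_cos_arg]
  · rw [← hnorm, Complex.norm_mul_sin_arg]

/-- A planar curve rotating about the origin with continuous angular speed has a differentiable
angle function. -/
lemma exists_angle_lift {x y F : ℝ → ℝ} {ρ : ℝ} (hρ : 0 < ρ) (hF : Continuous F)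
    (hx : ∀ t, HasDerivAt x (-(F t * y t)) t) (hy : ∀ t, HasDerivAt y (F t * x t) t)
    (h0 : x 0 ^ 2 + y 0 ^ 2 = ρ ^ 2) :
    ∃ φ : ℝ → ℝ, (∀ t, HasDerivAt φ (F t) t) ∧
      ∀ t, x t = ρ * cos (φ t) ∧ y t = ρ * sin (φ t) := by
  obtain ⟨θ, hx0, hy0⟩ := exists_angle_of_sq_add_sq hρ h0
  set φ : ℝ → ℝ := fun t => θ + ∫ s in (0 : ℝ)..t, F s with hφdef
  have hφ : ∀ t, HasDerivAt φ (F t) t := fun t =>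
    ((hF.integral_hasStrictDerivAt 0 t).hasDerivAt).const_add _
  have hφ0 : φ 0 = θ := by simp [hφdef]
  rw [← hφ0] at hx0 hy0
  have hu : ∀ t, x t * cos (φ t) + y t * sin (φ t) = ρ := by
    have hd : ∀ t, HasDerivAt (fun t => x t * cos (φ t) + y t * sin (φ t)) 0 t := by
      intro t
      refine (((hx t).mul (hφ t).cos).add ((hy t).mul (hφ t).sin)).congr_deriv ?_
      ring
    intro t
    have := eq_of_hasDerivAt_zero hd t 0
    rw [this, hx0, hy0]
    linear_combination ρ * sin_sq_add_cos_sq (φ 0)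
  have hv : ∀ t, y t * cos (φ t) - x t * sin (φ t) = 0 := by
    have hd : ∀ t, HasDerivAt (fun t => y t * cos (φ t) - x t * sin (φ t)) 0 t := by
      intro t
      refine (((hy t).mul (hφ t).cos).sub ((hx t).mul (hφ t).sin)).congr_deriv ?_
      ring
    intro t
    have := eq_of_hasDerivAt_zero hd t 0
    rw [this, hx0, hy0]
    ring
  refine ⟨φ, hφ, fun t => ⟨?_, ?_⟩⟩
  · linear_combination cos (φ t) * hu t - sin (φ t) * hv t - x t * sin_sq_add_cos_sq (φ t)
  · linear_combination sin (φ t) * hu t + cos (φ t) * hv t - y t * sin_sq_add_cos_sq (φ t)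

/-- Along a least period, an angle evolving by an autonomous equation of constant sign `ε` makes
exactly one turn, in the direction `ε`. -/
lemma angle_eq_add_of_least_period {F φ : ℝ → ℝ} {ε : ℤ} {T : ℝ} (hε : ε = 1 ∨ ε = -1)
    (hF : Continuous F) (hper : Function.Periodic F (2 * π)) (hpos : ∀ θ, 0 < (ε : ℝ) * F θ)
    (hφ : ∀ t, HasDerivAt φ (F (φ t)) t) (hT : 0 < T) {m : ℤ}
    (hm : φ T = φ 0 + m * (2 * π))
    (hmin : ∀ T', 0 < T' → (∀ t, ∃ l : ℤ, φ (t + T') = φ t + l * (2 * π)) → T ≤ T') :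
    φ T = φ 0 + ε * (2 * π) := by
  have hεε : (ε : ℝ) * ε = 1 := by rcases hε with rfl | rfl <;> norm_num
  have hF0 : ∀ θ, F θ ≠ 0 := fun θ h => by simpa [h] using hpos θ
  have hcont : Continuous fun θ => (F θ)⁻¹ := hF.inv₀ hF0
  set G : ℝ → ℝ := fun θ => ∫ s in (0 : ℝ)..θ, (F s)⁻¹ with hGdef
  have hG : ∀ θ, HasDerivAt G (F θ)⁻¹ θ := fun θ =>
    (hcont.integral_hasStrictDerivAt 0 θ).hasDerivAt
  have hG0 : G 0 = 0 := by simp [hGdef]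
  have hmono : StrictMono fun θ => (ε : ℝ) * G θ := by
    refine strictMono_of_hasDerivAt_pos (fun θ => (hG θ).const_mul (ε : ℝ)) fun θ => ?_
    have h := div_pos (hpos θ) (pow_pos (abs_pos.2 (hF0 θ)) 2)
    rw [sq_abs] at h
    refine h.trans_eq ?_
    have := hF0 θ
    field_simp
  have hinj : Function.Injective G := fun a b hab =>
    hmono.injective (show (ε : ℝ) * G a = ε * G b by rw [hab])
  have hGφ : ∀ t, G (φ t) = t + G (φ 0) := by
    have hd : ∀ t, HasDerivAt (fun t => G (φ t) - t) 0 t := by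
      intro t
      refine (((hG (φ t)).comp t (hφ t)).sub (hasDerivAt_id t)).congr_deriv ?_
      rw [inv_mul_cancel₀ (hF0 _), sub_self]
    intro t
    have := eq_of_hasDerivAt_zero hd t 0
    linarith
  have hGper : ∀ θ (l : ℤ), G (θ + l * (2 * π)) = G θ + l * G (2 * π) := by
    have h1 : ∀ θ, G (θ + 2 * π) = G θ + G (2 * π) := by
      have hd : ∀ θ, HasDerivAt (fun θ => G (θ + 2 * π) - G θ) 0 θ := by
        intro θ
        refine (((hG (θ + 2 * π)).comp_add_const θ (2 * π)).sub (hG θ)).congr_deriv ?_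
        rw [hper θ, sub_self]
      intro θ
      have := eq_of_hasDerivAt_zero hd θ 0
      simp only [zero_add, hG0] at this
      linarith
    have hc : G (2 * π) / (2 * π) * (2 * π) = G (2 * π) :=
      div_mul_cancel₀ _ two_pi_pos.ne'
    have hP : Function.Periodic (fun θ => G θ - G (2 * π) / (2 * π) * θ) (2 * π) := by
      intro θ
      change G (θ + 2 * π) - _ * (θ + 2 * π) = G θ - _ * θ
      linear_combination h1 θ - hc
    intro θ l
    have h : G (θ + l * (2 * π)) - G (2 * π) / (2 * π) * (θ + l * (2 * π))
      = G θ - G (2 * π) / (2 * π) * θ := hP.int_mul l θ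
    linear_combination h + l * hc
  have hK : 0 < (ε : ℝ) * G (2 * π) := by
    have := hmono (show (0 : ℝ) < 2 * π by positivity)
    simpa [hG0] using this
  have hTm : T = m * G (2 * π) := by
    have h := hGφ T
    rw [hm, hGper] at h
    linarith
  have hle : T ≤ ε * G (2 * π) := by
    refine hmin _ hK fun t => ⟨ε, hinj ?_⟩
    rw [hGφ, hGper, hGφ t]
    ring
  have hTm' : T = ((m * ε : ℤ) : ℝ) * (ε * G (2 * π)) := by
    push_cast
    linear_combination hTm - m * G (2 * π) * hεε
  have h1 : 0 < m * ε := by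
    by_contra! h
    have : ((m * ε : ℤ) : ℝ) ≤ 0 := by exact_mod_cast h
    nlinarith
  have h2 : m * ε ≤ 1 := by
    by_contra! h
    have : (1 : ℝ) < ((m * ε : ℤ) : ℝ) := by exact_mod_cast h
    nlinarith
  have hmε : m = ε := by rcases hε with rfl | rfl <;> omega
  rw [hm, hmε]

open Complex in
lemma circleIntegral_sub_inv_eq_ite {ρ : ℝ} (hρ : 0 < ρ) {w : ℂ} (hw : ‖w‖ ≠ ρ) :
    (∮ z in C(0, ρ), (z - w)⁻¹) = if ‖w‖ < ρ then 2 * π * I else 0 := by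
  split_ifs with h
  · exact circleIntegral.integral_sub_inv_of_mem_ball (by simpa using h)
  · have hout : ∀ z ∈ Metric.closedBall (0 : ℂ) ρ, z - w ≠ 0 := by
      intro z hz h0
      rw [sub_eq_zero] at h0
      subst h0
      exact hw (le_antisymm (by simpa using hz) (not_lt.1 h))
    refine circleIntegral_eq_zero_of_differentiable_on_off_countable hρ.le
      Set.countable_empty ?_ ?_
    · exact (continuousOn_id.sub continuousOn_const).inv₀ hout
    · intro z hz
      exact (differentiableAt_id.sub_const w).inv
        (hout z (Metric.ball_subset_closedBall hz.1))

/-- The mean over the circle of radius `ρ` of `z · (z - w) / |z - w|²`. -/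
lemma integral_radial_kernel {ρ u v : ℝ} (hρ : 0 < ρ) (hw : u ^ 2 + v ^ 2 ≠ ρ ^ 2) (a : ℝ) :
    (∫ θ in a..a + 2 * π,
      (ρ * cos θ * (ρ * cos θ - u) + ρ * sin θ * (ρ * sin θ - v)) /
        ((ρ * cos θ - u) ^ 2 + (ρ * sin θ - v) ^ 2))
      = if u ^ 2 + v ^ 2 < ρ ^ 2 then 2 * π else 0 := by
  have hP : Function.Periodic (fun θ =>
      (ρ * cos θ * (ρ * cos θ - u) + ρ * sin θ * (ρ * sin θ - v)) /
        ((ρ * cos θ - u) ^ 2 + (ρ * sin θ - v) ^ 2)) (2 * π) := by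
    intro θ
    simp only [cos_add_two_pi, sin_add_two_pi]
  rw [hP.intervalIntegral_add_eq a 0, zero_add]
  set w : ℂ := ⟨u, v⟩ with hwdef
  have hnsq : ‖w‖ ^ 2 = u ^ 2 + v ^ 2 := by
    rw [Complex.sq_norm, Complex.normSq_apply]
    ring
  have hne : ‖w‖ ≠ ρ := fun h => hw (by rw [← hnsq, h])
  have hiff : ‖w‖ < ρ ↔ u ^ 2 + v ^ 2 < ρ ^ 2 := by
    rw [← hnsq]
    exact (pow_lt_pow_iff_left₀ (norm_nonneg _) hρ.le two_ne_zero).symm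
  have key := circleIntegral_sub_inv_eq_ite hρ hne
  rw [circleIntegral] at key
  have hsub : ∀ θ, circleMap 0 ρ θ - w ≠ 0 := by
    intro θ h
    rw [sub_eq_zero] at h
    apply hne
    rw [← h]
    simp [abs_of_pos hρ]
  have hint : IntervalIntegrable
      (fun θ => deriv (circleMap 0 ρ) θ • (circleMap 0 ρ θ - w)⁻¹) MeasureTheory.volume 0
      (2 * π) := by
    apply Continuous.intervalIntegrable
    simp only [deriv_circleMap]
    have h1 : Continuous (circleMap 0 ρ) := continuous_circleMap 0 ρ
    exact (h1.mul continuous_const).smul ((h1.sub continuous_const).inv₀ hsub)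
  have him := congrArg Complex.im key
  rw [← Complex.imCLM_apply, ← ContinuousLinearMap.intervalIntegral_comp_comm _ hint] at him
  have hval : (if ‖w‖ < ρ then 2 * (π : ℂ) * Complex.I else 0).im
      = if u ^ 2 + v ^ 2 < ρ ^ 2 then 2 * π else 0 := by
    simp only [hiff]
    split_ifs <;> simp
  rw [← hval, ← him]
  congr 1
  ext θ
  have hre : (circleMap 0 ρ θ).re = ρ * cos θ := by
    simp [circleMap, Complex.exp_re]
  have him' : (circleMap 0 ρ θ).im = ρ * sin θ := by
    simp [circleMap, Complex.exp_im]
  have hn : Complex.normSq (circleMap 0 ρ θ - w)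
      = (ρ * cos θ - u) ^ 2 + (ρ * sin θ - v) ^ 2 := by
    rw [Complex.normSq_apply, Complex.sub_re, Complex.sub_im, hre, him']
    simp only [hwdef]
    ring
  have hn0 : (ρ * cos θ - u) ^ 2 + (ρ * sin θ - v) ^ 2 ≠ 0 := by
    rw [← hn]
    exact (Complex.normSq_pos.2 (hsub θ)).ne'
  simp only [Complex.imCLM_apply, deriv_circleMap, smul_eq_mul, Complex.mul_im, Complex.mul_re,
    Complex.inv_re, Complex.inv_im, hn, Complex.sub_re, Complex.sub_im, hre, him',
    Complex.I_re, Complex.I_im]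
  simp only [hwdef]
  field_simp
  ring

section Evaluation

variable (p : ℝ × ℝ)

lemma pev_add (P Q : Poly2) : pev (P + Q) p = pev P p + pev Q p := map_add _ P Q

lemma pev_sub (P Q : Poly2) : pev (P - Q) p = pev P p - pev Q p := map_sub _ P Q

lemma pev_mul (P Q : Poly2) : pev (P * Q) p = pev P p * pev Q p := map_mul _ P Q

lemma pev_C (a : ℝ) : pev (MvPolynomial.C a) p = a := MvPolynomial.eval_C a

lemma pev_sum {ι : Type*} (s : Finset ι) (f : ι → Poly2) :
    pev (∑ i ∈ s, f i) p = ∑ i ∈ s, pev (f i) p := map_sum _ f s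

lemma pev_prod {ι : Type*} (s : Finset ι) (f : ι → Poly2) :
    pev (∏ i ∈ s, f i) p = ∏ i ∈ s, pev (f i) p := map_prod _ f s

lemma pev_pderiv_mul (i : Fin 2) (P Q : Poly2) :
    pev (pderiv i (P * Q)) p = pev (pderiv i P) p * pev Q p + pev P p * pev (pderiv i Q) p := by
  rw [pderiv_mul, pev_add, pev_mul, pev_mul]

/-- The derivative of a product, through logarithmic derivatives. -/
lemma pev_pderiv_prod {ι : Type*} (i : Fin 2) (s : Finset ι) (f : ι → Poly2)
    (h : ∀ j ∈ s, pev (f j) p ≠ 0) :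
    pev (pderiv i (∏ j ∈ s, f j)) p
      = pev (∏ j ∈ s, f j) p * ∑ j ∈ s, pev (pderiv i (f j)) p / pev (f j) p := by
  induction s using Finset.induction_on with
  | empty => simp [pev]
  | insert a s ha ih =>
    rw [Finset.prod_insert ha, Finset.sum_insert ha, pev_pderiv_mul, pev_mul,
      ih fun j hj => h j (Finset.mem_insert_of_mem hj)]
    have := h a (Finset.mem_insert_self a s)
    field_simp

lemma pev_gpoly (c : ℝ × ℝ) : pev (gpoly c) p = (p.1 - c.1) ^ 2 + (p.2 - c.2) ^ 2 := by
  simp [pev, gpoly]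

lemma pev_pderiv_zero_gpoly (c : ℝ × ℝ) : pev (pderiv 0 (gpoly c)) p = 2 * (p.1 - c.1) := by
  simp [pev, gpoly, pderiv_X]

lemma pev_pderiv_one_gpoly (c : ℝ × ℝ) : pev (pderiv 1 (gpoly c)) p = 2 * (p.2 - c.2) := by
  simp [pev, gpoly, pderiv_X]

variable (ctr : Fin n → ℝ × ℝ) (rad : Fin n → ℝ)

lemma pev_fk (k : Fin n) :
    pev (fk ctr rad k) p = (p.1 - (ctr k).1) ^ 2 + (p.2 - (ctr k).2) ^ 2 - rad k ^ 2 := by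
  simp [pev, fk, fpoly]

lemma pev_pderiv_zero_fk (k : Fin n) :
    pev (pderiv 0 (fk ctr rad k)) p = 2 * (p.1 - (ctr k).1) := by
  simp [pev, fk, fpoly, pderiv_X]

lemma pev_pderiv_one_fk (k : Fin n) :
    pev (pderiv 1 (fk ctr rad k)) p = 2 * (p.2 - (ctr k).2) := by
  simp [pev, fk, fpoly, pderiv_X]

lemma pderiv_pderiv_fk {i i' : Fin 2} (h : i ≠ i') (k : Fin n) :
    pderiv i (pderiv i' (fk ctr rad k)) = 0 := by
  fin_cases i <;> fin_cases i' <;> simp_all [fk, fpoly, pderiv_X, pow_two]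

end Evaluation

lemma mem_Ccir {ctr : Fin n → ℝ × ℝ} {rad : Fin n → ℝ} {k : Fin n} {p : ℝ × ℝ} :
    p ∈ Ccir ctr rad k ↔
      (p.1 - (ctr k).1) ^ 2 + (p.2 - (ctr k).2) ^ 2 - rad k ^ 2 = 0 := by
  rw [Ccir, Set.mem_ofPred_eq, pev_fk]

/-- The chain rule for a polynomial along a differentiable plane curve. -/
lemma hasDerivAt_pev (P : Poly2) {γ : ℝ → ℝ × ℝ} {t a b : ℝ}
    (h1 : HasDerivAt (fun t => (γ t).1) a t) (h2 : HasDerivAt (fun t => (γ t).2) b t) :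
    HasDerivAt (fun t => pev P (γ t))
      (pev (pderiv 0 P) (γ t) * a + pev (pderiv 1 P) (γ t) * b) t := by
  induction P using MvPolynomial.induction_on with
  | C c => simpa [pev] using hasDerivAt_const t c
  | add P Q hP hQ =>
    simp only [pev_add, map_add]
    exact (hP.add hQ).congr_deriv (by ring)
  | mul_X P i hP =>
    simp only [pev_mul, pev_pderiv_mul]
    fin_cases i
    · refine (hP.mul (h1.congr_of_eventuallyEq (f₁ := fun t => pev (X 0) (γ t)) ?_)).congr_deriv ?_
      · simp [pev]
      · simp [pev, pderiv_X]
        ring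
    · refine (hP.mul (h2.congr_of_eventuallyEq (f₁ := fun t => pev (X 1) (γ t)) ?_)).congr_deriv ?_
      · simp [pev]
      · simp [pev, pderiv_X]
        ring

section OnCircle

variable {ctr : Fin n → ℝ × ℝ} {rad τ : Fin n → ℝ} {k : Fin n} {p : ℝ × ℝ}

lemma pev_Apoly_eq_zero (hp : pev (fk ctr rad k) p = 0) : pev (Apoly ctr rad) p = 0 := by
  rw [Apoly, pev_prod]
  exact Finset.prod_eq_zero (Finset.mem_univ k) hp

lemma pev_pderiv_Apoly (hp : pev (fk ctr rad k) p = 0) (i : Fin 2) :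
    pev (pderiv i (Apoly ctr rad)) p
      = pev (pderiv i (fk ctr rad k)) p * pev (muk ctr rad k) p := by
  rw [Apoly, ← Finset.mul_prod_erase Finset.univ (fk ctr rad) (Finset.mem_univ k),
    pev_pderiv_mul, hp, zero_mul, add_zero]
  rfl

lemma muk_eq_mul {j : Fin n} (h : j ≠ k) : muk ctr rad j
    = fk ctr rad k * ∏ l ∈ (Finset.univ.erase j).erase k, fk ctr rad l := by
  rw [muk, Finset.mul_prod_erase]
  exact Finset.mem_erase.2 ⟨h.symm, Finset.mem_univ k⟩

lemma pev_muk_of_ne (hp : pev (fk ctr rad k) p = 0) {j : Fin n} (h : j ≠ k) :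
    pev (muk ctr rad j) p = 0 := by
  rw [muk_eq_mul h, pev_mul, hp, zero_mul]

lemma pev_pderiv_muk_of_ne (hp : pev (fk ctr rad k) p = 0) {j : Fin n} (h : j ≠ k)
    (hj : pev (fk ctr rad j) p ≠ 0) (i : Fin 2) :
    pev (pderiv i (muk ctr rad j)) p
      = pev (pderiv i (fk ctr rad k)) p * (pev (muk ctr rad k) p / pev (fk ctr rad j) p) := by
  rw [muk_eq_mul h, pev_pderiv_mul, hp, zero_mul, add_zero, muk_eq_mul h.symm, pev_mul,
    mul_div_cancel_left₀ _ hj, Finset.erase_right_comm]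

lemma pev_sum_muk (hp : pev (fk ctr rad k) p = 0) (i : Fin 2) :
    pev (∑ j, MvPolynomial.C (τ j) * muk ctr rad j * pderiv i (fk ctr rad j)) p
      = τ k * pev (muk ctr rad k) p * pev (pderiv i (fk ctr rad k)) p := by
  rw [pev_sum, Finset.sum_eq_single k]
  · rw [pev_mul, pev_mul, pev_C]
  · intro j _ hj
    rw [pev_mul, pev_mul, pev_muk_of_ne hp hj, mul_zero, zero_mul]
  · simp

lemma pev_pderiv_sum_muk (hp : pev (fk ctr rad k) p = 0)
    (hne : ∀ j, j ≠ k → pev (fk ctr rad j) p ≠ 0) {i i' : Fin 2} (hi : i' ≠ i) :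
    pev (pderiv i' (∑ j, MvPolynomial.C (τ j) * muk ctr rad j * pderiv i (fk ctr rad j))) p
      = ∑ j ∈ Finset.univ.erase k, pev (muk ctr rad k) p / pev (fk ctr rad j) p *
        (τ k * (pev (pderiv i' (fk ctr rad j)) p * pev (pderiv i (fk ctr rad k)) p)
          + τ j * (pev (pderiv i' (fk ctr rad k)) p * pev (pderiv i (fk ctr rad j)) p)) := by
  have hterm : ∀ j, pev (pderiv i' (MvPolynomial.C (τ j) * muk ctr rad j *
      pderiv i (fk ctr rad j))) p
      = τ j * pev (pderiv i' (muk ctr rad j)) p * pev (pderiv i (fk ctr rad j)) p := by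
    intro j
    rw [pev_pderiv_mul, pderiv_pderiv_fk _ _ hi, pderiv_C_mul, pev_mul,
      pev_C]
    simp [pev]
  rw [map_sum, pev_sum, ← Finset.add_sum_erase _ _ (Finset.mem_univ k), hterm, muk,
    pev_pderiv_prod _ _ _ _ fun j hj => hne j (Finset.ne_of_mem_erase hj), ← muk,
    Finset.mul_sum, Finset.mul_sum, Finset.sum_mul, ← Finset.sum_add_distrib]
  refine Finset.sum_congr rfl fun j hj => ?_
  have hjk := Finset.ne_of_mem_erase hj
  rw [hterm, pev_pderiv_muk_of_ne hp hjk (hne j hjk)]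
  ring

variable {r : ℕ}

lemma pev_PT (hp : pev (fk ctr rad k) p = 0) :
    pev (PT r ctr rad τ) p = -(2 * τ k * pev (Bpoly r ctr) p * pev (muk ctr rad k) p *
      (p.2 - (ctr k).2)) := by
  rw [PT, pev_sub, pev_mul, pev_mul, pev_Apoly_eq_zero hp, pev_sum_muk hp, pev_pderiv_one_fk]
  ring

lemma pev_QT (hp : pev (fk ctr rad k) p = 0) :
    pev (QT r ctr rad τ) p = 2 * τ k * pev (Bpoly r ctr) p * pev (muk ctr rad k) p *
      (p.1 - (ctr k).1) := by
  rw [QT, pev_add, pev_mul, pev_mul, pev_Apoly_eq_zero hp, pev_sum_muk hp, pev_pderiv_zero_fk]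
  ring

/-- On the circle `C_k` the divergence is a radial term plus a logarithmic derivative along the
field. -/
lemma pev_divPoly (hp : pev (fk ctr rad k) p = 0)
    (hne : ∀ j, j ≠ k → pev (fk ctr rad j) p ≠ 0) (hB : pev (Bpoly r ctr) p ≠ 0)
    (hτ : τ k ≠ 0) :
    pev (divPoly (PT r ctr rad τ) (QT r ctr rad τ)) p
      = 2 * pev (Bpoly r ctr) p * pev (muk ctr rad k) p *
          ((p.1 - (ctr k).1) * (pev (pderiv 0 (Bpoly r ctr)) p / pev (Bpoly r ctr) p) +
            (p.2 - (ctr k).2) * (pev (pderiv 1 (Bpoly r ctr)) p / pev (Bpoly r ctr) p))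
        + ((1 - 1 / τ k) * ((pev (pderiv 0 (Bpoly r ctr)) p * pev (PT r ctr rad τ) p +
            pev (pderiv 1 (Bpoly r ctr)) p * pev (QT r ctr rad τ) p) / pev (Bpoly r ctr) p)
          - ∑ j ∈ Finset.univ.erase k, (τ j / τ k - 1) *
            ((pev (pderiv 0 (fk ctr rad j)) p * pev (PT r ctr rad τ) p +
              pev (pderiv 1 (fk ctr rad j)) p * pev (QT r ctr rad τ) p) /
                pev (fk ctr rad j) p)) := by
  have hsum : ∑ j ∈ Finset.univ.erase k, (τ j / τ k - 1) *
      ((pev (pderiv 0 (fk ctr rad j)) p * pev (PT r ctr rad τ) p +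
        pev (pderiv 1 (fk ctr rad j)) p * pev (QT r ctr rad τ) p) / pev (fk ctr rad j) p)
      = pev (Bpoly r ctr) p *
        (pev (pderiv 0 (∑ j, MvPolynomial.C (τ j) * muk ctr rad j * pderiv 1 (fk ctr rad j))) p
        - pev (pderiv 1 (∑ j, MvPolynomial.C (τ j) * muk ctr rad j *
            pderiv 0 (fk ctr rad j))) p) := by
    rw [pev_pderiv_sum_muk hp hne zero_ne_one, pev_pderiv_sum_muk hp hne one_ne_zero,
      ← Finset.sum_sub_distrib, Finset.mul_sum]
    refine Finset.sum_congr rfl fun j hj => ?_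
    have := hne j (Finset.ne_of_mem_erase hj)
    rw [pev_PT hp, pev_QT hp]
    simp only [pev_pderiv_zero_fk, pev_pderiv_one_fk]
    field_simp
    ring
  rw [hsum, pev_PT hp, pev_QT hp, divPoly, pev_add, PT, QT, map_sub, map_add, pev_sub, pev_add]
  simp only [pev_pderiv_mul, pev_Apoly_eq_zero hp, pev_pderiv_Apoly hp, pev_sum_muk hp,
    pev_sub, pev_add]
  simp only [pev_pderiv_zero_fk, pev_pderiv_one_fk]
  field_simp
  ring

end OnCircle

lemma continuous_pev (P : Poly2) : Continuous (pev P) :=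
  (MvPolynomial.continuous_eval P).comp (by fun_prop)

lemma neg_one_pow_card_mul_prod_pos {ι : Type*} (s : Finset ι) (a : ι → ℝ)
    (h : ∀ j ∈ s, a j ≠ 0) :
    0 < (-1 : ℝ) ^ (s.filter fun j => a j < 0).card * ∏ j ∈ s, a j := by
  rw [← Finset.prod_const, Finset.prod_filter, ← Finset.prod_mul_distrib]
  refine Finset.prod_pos fun j hj => ?_
  split_ifs with hneg
  · linarith
  · rw [one_mul]
    exact lt_of_le_of_ne (not_lt.1 hneg) (h j hj).symm

section Geometry

variable {ctr : Fin n → ℝ × ℝ} {rad : Fin n → ℝ} {j k : Fin n}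

lemma pev_fk_ne_zero (hdisj : Disjoint (Ccir ctr rad j) (Ccir ctr rad k)) {p : ℝ × ℝ}
    (hp : p ∈ Ccir ctr rad k) : pev (fk ctr rad j) p ≠ 0 := fun h =>
  Set.disjoint_left.1 hdisj h hp

/-- A circle disjoint from `C_k` has `C_k` entirely on one side. -/
lemma pev_fk_neg_of_neg (hk : 0 < rad k)
    (hdisj : Disjoint (Ccir ctr rad j) (Ccir ctr rad k)) {p q : ℝ × ℝ}
    (hp : p ∈ Ccir ctr rad k) (hq : q ∈ Ccir ctr rad k) (h : pev (fk ctr rad j) p < 0) :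
    pev (fk ctr rad j) q < 0 := by
  set pt : ℝ → ℝ × ℝ := fun θ => ((ctr k).1 + rad k * cos θ, (ctr k).2 + rad k * sin θ) with hpt
  have hex : ∀ x ∈ Ccir ctr rad k, ∃ θ, pt θ = x := by
    intro x hx
    obtain ⟨θ, h1, h2⟩ := exists_angle_of_sq_add_sq hk (sub_eq_zero.1 (mem_Ccir.1 hx))
    exact ⟨θ, Prod.ext (by simp [hpt, ← h1]) (by simp [hpt, ← h2])⟩
  have hmem : ∀ θ, pt θ ∈ Ccir ctr rad k := by
    intro θ
    rw [mem_Ccir]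
    simp only [hpt]
    linear_combination rad k ^ 2 * sin_sq_add_cos_sq θ
  obtain ⟨α, rfl⟩ := hex p hp
  obtain ⟨β, rfl⟩ := hex q hq
  by_contra! hβ
  have hcont : Continuous fun θ => pev (fk ctr rad j) (pt θ) :=
    (continuous_pev _).comp (by fun_prop)
  obtain ⟨θ, hθ⟩ := mem_range_of_exists_le_of_exists_ge hcont ⟨α, h.le⟩ ⟨β, hβ⟩
  exact pev_fk_ne_zero hdisj (hmem θ) hθ

lemma mem_Ddisc_iff {p : ℝ × ℝ} : p ∈ Ddisc ctr rad j ↔ pev (fk ctr rad j) p ≤ 0 := by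
  rw [pev_fk, sub_nonpos, Ddisc, Set.mem_ofPred_eq]

lemma pev_fk_neg_iff (hk : 0 < rad k) (hdisj : Disjoint (Ccir ctr rad j) (Ccir ctr rad k))
    {p : ℝ × ℝ} (hp : p ∈ Ccir ctr rad k) :
    pev (fk ctr rad j) p < 0 ↔ Ccir ctr rad k ⊆ Ddisc ctr rad j := by
  refine ⟨fun h q hq => ?_, fun h => ?_⟩
  · exact mem_Ddisc_iff.2 (pev_fk_neg_of_neg hk hdisj hp hq h).le
  · exact lt_of_le_of_ne (mem_Ddisc_iff.1 (h hp)) (pev_fk_ne_zero hdisj hp)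

/-- A primary circle lies in the disc bounded by `C_k` as soon as its center does. -/
lemma Ccir_subset_Ddisc_iff (hrad : ∀ k, 0 < rad k)
    (hdisj : j ≠ k → Disjoint (Ccir ctr rad j) (Ccir ctr rad k)) (hj : Primary ctr rad j) :
    Ccir ctr rad j ⊆ Ddisc ctr rad k ↔
      ((ctr j).1 - (ctr k).1) ^ 2 + ((ctr j).2 - (ctr k).2) ^ 2 < rad k ^ 2 := by
  have hrj := hrad j
  have hrk := hrad k
  constructor
  · intro h
    have h1 := @h ((ctr j).1 + rad j, (ctr j).2) (mem_Ccir.2 (by simp))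
    have h2 := @h ((ctr j).1 - rad j, (ctr j).2) (mem_Ccir.2 (by simp))
    simp only [Ddisc, Set.mem_ofPred_eq] at h1 h2
    nlinarith [pow_pos hrj 2]
  · intro h
    rcases eq_or_ne j k with rfl | hjk
    · exact fun p hp => mem_Ddisc_iff.2 (le_of_eq hp)
    set d := √(((ctr j).1 - (ctr k).1) ^ 2 + ((ctr j).2 - (ctr k).2) ^ 2) with hd
    have hd0 : 0 ≤ d := Real.sqrt_nonneg _
    have hdsq : d ^ 2 = ((ctr j).1 - (ctr k).1) ^ 2 + ((ctr j).2 - (ctr k).2) ^ 2 :=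
      Real.sq_sqrt (by positivity)
    have hdk : d < rad k := by
      rw [← hdsq] at h
      exact lt_of_pow_lt_pow_left₀ 2 hrk.le h
    obtain ⟨α, hα1, hα2⟩ : ∃ α, (ctr j).1 - (ctr k).1 = d * cos α ∧
        (ctr j).2 - (ctr k).2 = d * sin α := by
      rcases hd0.eq_or_lt with h0 | h0
      · refine ⟨0, ?_, ?_⟩ <;> rw [← h0] at hdsq ⊢ <;>
          nlinarith [sq_nonneg ((ctr j).1 - (ctr k).1), sq_nonneg ((ctr j).2 - (ctr k).2)]
      · exact exists_angle_of_sq_add_sq h0 hdsq.symm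
    set q : ℝ × ℝ := ((ctr k).1 + rad k * cos α, (ctr k).2 + rad k * sin α) with hqdef
    have hq : q ∈ Ccir ctr rad k := by
      rw [mem_Ccir]
      simp only [hqdef]
      linear_combination rad k ^ 2 * sin_sq_add_cos_sq α
    have hval : pev (fk ctr rad j) q = (rad k - d) ^ 2 - rad j ^ 2 := by
      have e1 : (ctr j).1 = (ctr k).1 + d * cos α := by linarith
      have e2 : (ctr j).2 = (ctr k).2 + d * sin α := by linarith
      rw [pev_fk]
      simp only [hqdef, e1, e2]
      linear_combination (rad k - d) ^ 2 * sin_sq_add_cos_sq α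
    have hnn : 0 ≤ pev (fk ctr rad j) q := by
      by_contra! hneg
      exact hj k hjk.symm ((pev_fk_neg_iff hrk (hdisj hjk) hq).1 hneg)
    have hle : rad j ≤ rad k - d := by
      rw [hval, sub_nonneg] at hnn
      exact le_of_sq_le_sq hnn (by linarith)
    intro p hp
    obtain ⟨β, hβ1, hβ2⟩ := exists_angle_of_sq_add_sq hrj (sub_eq_zero.1 (mem_Ccir.1 hp))
    have e1 : p.1 - (ctr k).1 = d * cos α + rad j * cos β := by linarith
    have e2 : p.2 - (ctr k).2 = d * sin α + rad j * sin β := by linarith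
    rw [Ddisc, Set.mem_ofPred_eq, e1, e2]
    have hc := Real.cos_le_one (α - β)
    rw [Real.cos_sub] at hc
    have hmul := mul_le_mul_of_nonneg_left hc (mul_nonneg hd0 hrj.le)
    calc _ = d ^ 2 + rad j ^ 2 + 2 * (d * rad j * (cos α * cos β + sin α * sin β)) := by
          linear_combination d ^ 2 * sin_sq_add_cos_sq α + rad j ^ 2 * sin_sq_add_cos_sq β
      _ ≤ (d + rad j) ^ 2 := by linarith
      _ ≤ rad k ^ 2 := by
          apply pow_le_pow_left₀ <;> linarith

lemma neg_one_pow_Nk_mul_muk_pos (hrad : ∀ k, 0 < rad k)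
    (hdisj : ∀ j k, j ≠ k → Disjoint (Ccir ctr rad j) (Ccir ctr rad k)) {p : ℝ × ℝ}
    (hp : p ∈ Ccir ctr rad k) : 0 < (-1 : ℝ) ^ Nk ctr rad k * pev (muk ctr rad k) p := by
  have h := neg_one_pow_card_mul_prod_pos (Finset.univ.erase k)
    (fun j => pev (fk ctr rad j) p)
    fun j hj => pev_fk_ne_zero (hdisj j k (Finset.ne_of_mem_erase hj)) hp
  rw [muk, pev_prod]
  convert h using 3
  rw [Nk, Nat.card_eq_fintype_card, Fintype.card_subtype]
  congr 1
  ext j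
  simp only [Finset.mem_filter, Finset.mem_univ, true_and, Finset.mem_erase, and_true]
  exact and_congr_right fun hj => (pev_fk_neg_iff (hrad k) (hdisj j k hj) hp).symm

lemma pev_gpoly_pos (hctr : ∀ j, ctr j ∉ Ccir ctr rad k) {p : ℝ × ℝ}
    (hp : p ∈ Ccir ctr rad k) (j : Fin n) : 0 < pev (gpoly (ctr j)) p := by
  rw [pev_gpoly]
  by_contra! h
  have h1 : p.1 - (ctr j).1 = 0 := by
    nlinarith [sq_nonneg (p.1 - (ctr j).1), sq_nonneg (p.2 - (ctr j).2)]
  have h2 : p.2 - (ctr j).2 = 0 := by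
    nlinarith [sq_nonneg (p.1 - (ctr j).1), sq_nonneg (p.2 - (ctr j).2)]
  refine hctr j ?_
  rwa [show ctr j = p from Prod.ext (by linarith) (by linarith)]

end Geometry

/-- For any periodic solution `γ_k` of `X_T` parametrizing the circle `C_k`
with least period `T*_k`, the characteristic exponent equals
`∫₀^{T*_k} div X_T(γ_k(t)) dt = (−1)^{N_k} · 4π s_k / τ_k`. -/
theorem characteristic_exponent_XT
    (r : ℕ) (ctr : Fin n → ℝ × ℝ) (rad τ : Fin n → ℝ)
    (hn : 1 ≤ n) (hrn : r ≤ n) (hrad : ∀ k, 0 < rad k)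
    (hdisj : ∀ j k, j ≠ k → Disjoint (Ccir ctr rad j) (Ccir ctr rad k))
    (hctr : ∀ j k, ctr j ∉ Ccir ctr rad k)
    (hprim : ∀ k, Primary ctr rad k ↔ (k : ℕ) < r)
    (hτ : ∀ k, 0 < τ k) (k : Fin n)
    (γ : ℝ → ℝ × ℝ) (T : ℝ)
    (hsol : IsSolution (PT r ctr rad τ) (QT r ctr rad τ) γ)
    (hrange : Set.range γ = Ccir ctr rad k)
    (hleast : IsLeastPeriod γ T) :
    (∫ t in (0:ℝ)..T, pev (divPoly (PT r ctr rad τ) (QT r ctr rad τ)) (γ t))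
      = (-1 : ℝ) ^ (Nk ctr rad k) * (4 * π * (sk r ctr rad k : ℝ)) / τ k := by
  obtain ⟨hT, hperiod, hmin⟩ := hleast
  have hk := hrad k
  have hτk := (hτ k).ne'
  have hdk : ∀ j, j ≠ k → Disjoint (Ccir ctr rad j) (Ccir ctr rad k) := fun j => hdisj j k
  have hmem : ∀ t, γ t ∈ Ccir ctr rad k := fun t => hrange ▸ Set.mem_range_self t
  have hne : ∀ p ∈ Ccir ctr rad k, ∀ j, j ≠ k → pev (fk ctr rad j) p ≠ 0 :=
    fun p hp j hj => pev_fk_ne_zero (hdk j hj) hp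
  have hg : ∀ p ∈ Ccir ctr rad k, ∀ j, 0 < pev (gpoly (ctr j)) p :=
    fun p hp j => pev_gpoly_pos (fun j => hctr j k) hp j
  have hB : ∀ p ∈ Ccir ctr rad k, 0 < pev (Bpoly r ctr) p := fun p hp => by
    rw [Bpoly, pev_prod]
    exact Finset.prod_pos fun j _ => hg p hp j
  -- the coordinates relative to the center, and the angular speed
  have hγ1 : ∀ t, HasDerivAt (fun t => (γ t).1) (pev (PT r ctr rad τ) (γ t)) t :=
    fun t => (hsol t).fst
  have hγ2 : ∀ t, HasDerivAt (fun t => (γ t).2) (pev (QT r ctr rad τ) (γ t)) t :=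
    fun t => (hsol t).snd
  have hγcont : Continuous γ := continuous_iff_continuousAt.2 fun t => (hsol t).continuousAt
  set ω : ℝ × ℝ → ℝ := fun p => 2 * τ k * pev (Bpoly r ctr) p * pev (muk ctr rad k) p with hω
  have hωcont : Continuous ω :=
    (continuous_const.mul (continuous_pev _)).mul (continuous_pev _)
  obtain ⟨φ, hφ, hγφ⟩ := exists_angle_lift (x := fun t => (γ t).1 - (ctr k).1)
    (y := fun t => (γ t).2 - (ctr k).2) hk (hωcont.comp hγcont)
    (fun t => ((hγ1 t).sub_const _).congr_deriv (pev_PT (hmem t)))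
    (fun t => ((hγ2 t).sub_const _).congr_deriv (pev_QT (hmem t)))
    (sub_eq_zero.1 (mem_Ccir.1 (hmem 0)))
  set pt : ℝ → ℝ × ℝ := fun θ => ((ctr k).1 + rad k * cos θ, (ctr k).2 + rad k * sin θ) with hpt
  have hptcont : Continuous pt := by fun_prop
  have hptmem : ∀ θ, pt θ ∈ Ccir ctr rad k := fun θ => by
    rw [mem_Ccir]
    simp only [hpt]
    linear_combination rad k ^ 2 * sin_sq_add_cos_sq θ
  have hγpt : ∀ t, γ t = pt (φ t) := fun t =>
    Prod.ext (by simp [hpt, ← (hγφ t).1]) (by simp [hpt, ← (hγφ t).2])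
  -- the curve makes one turn, in the direction `(-1) ^ N_k`
  obtain ⟨m, hm⟩ : ∃ m : ℤ, φ T = φ 0 + m * (2 * π) := by
    have hT0 : γ T = γ 0 := by simpa using hperiod 0
    have hc : rad k * cos (φ T) = rad k * cos (φ 0) := by
      rw [← (hγφ T).1, ← (hγφ 0).1, hT0]
    have hs : rad k * sin (φ T) = rad k * sin (φ 0) := by
      rw [← (hγφ T).2, ← (hγφ 0).2, hT0]
    obtain ⟨m, hm⟩ := Real.Angle.angle_eq_iff_two_pi_dvd_sub.1
      (Real.Angle.cos_sin_inj (mul_left_cancel₀ hk.ne' hc) (mul_left_cancel₀ hk.ne' hs))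
    exact ⟨m, by linear_combination hm⟩
  set ε : ℤ := (-1) ^ Nk ctr rad k with hε
  have hεcast : (ε : ℝ) = (-1) ^ Nk ctr rad k := by simp [hε]
  have hε' : ε = 1 ∨ ε = -1 := neg_one_pow_eq_or ℤ _
  have hturn : φ T = φ 0 + ε * (2 * π) := by
    refine angle_eq_add_of_least_period (F := fun θ => ω (pt θ)) hε' (hωcont.comp hptcont)
      (fun θ => by simp only [hpt, cos_add_two_pi, sin_add_two_pi]) (fun θ => ?_)
      (fun t => hγpt t ▸ hφ t) hT hm fun T' hT' h => hmin T' hT' fun t => ?_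
    · have h1 := neg_one_pow_Nk_mul_muk_pos hrad hdisj (hptmem θ)
      have h2 := hB _ (hptmem θ)
      have h3 := hτ k
      rw [hεcast]
      calc 0 < 2 * τ k * pev (Bpoly r ctr) (pt θ) *
            ((-1) ^ Nk ctr rad k * pev (muk ctr rad k) (pt θ)) := by positivity
        _ = _ := by simp only [hω]; ring
    · obtain ⟨l, hl⟩ := h t
      rw [hγpt, hγpt, hl]
      simp only [hpt, cos_add_int_mul_two_pi, sin_add_int_mul_two_pi]
  -- the radial part of the divergence, as a function of the angle
  set κ : Fin n → ℝ → ℝ := fun j θ =>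
    (rad k * cos θ * (rad k * cos θ - ((ctr j).1 - (ctr k).1)) +
      rad k * sin θ * (rad k * sin θ - ((ctr j).2 - (ctr k).2))) /
    ((rad k * cos θ - ((ctr j).1 - (ctr k).1)) ^ 2 +
      (rad k * sin θ - ((ctr j).2 - (ctr k).2)) ^ 2) with hκ
  have hgpt : ∀ j θ, pev (gpoly (ctr j)) (pt θ)
      = (rad k * cos θ - ((ctr j).1 - (ctr k).1)) ^ 2 +
        (rad k * sin θ - ((ctr j).2 - (ctr k).2)) ^ 2 := fun j θ => by
    rw [pev_gpoly]
    simp only [hpt]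
    ring
  have hκcont : ∀ j, Continuous (κ j) := fun j => by
    refine Continuous.div (by fun_prop) (by fun_prop) fun θ => ?_
    rw [← hgpt]
    exact (hg _ (hptmem θ) j).ne'
  set S := Finset.univ.filter fun j : Fin n => (j : ℕ) < r with hS
  set K : ℝ → ℝ := fun θ => ∑ j ∈ S, κ j θ with hK
  have hKcont : Continuous K := continuous_finsetSum _ fun j _ => hκcont j
  have hKint : ∀ a, ∫ θ in a..a + 2 * π, K θ = 2 * π * sk r ctr rad k := by
    intro a
    rw [intervalIntegral.integral_finsetSum fun j _ => (hκcont j).intervalIntegrable _ _]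
    have hterm : ∀ j ∈ S, ∫ θ in a..a + 2 * π, κ j θ
        = if Ccir ctr rad j ⊆ Ddisc ctr rad k then 2 * π else 0 := by
      intro j hj
      rw [integral_radial_kernel hk (fun h => hctr j k (mem_Ccir.2 (sub_eq_zero.2 h)))]
      simp only [Ccir_subset_Ddisc_iff hrad (hdk j) ((hprim j).2 (Finset.mem_filter.1 hj).2)]
    rw [Finset.sum_congr rfl hterm, ← Finset.sum_filter, Finset.sum_const, hS,
      Finset.filter_filter, sk, Nat.card_eq_fintype_card, Fintype.card_subtype, nsmul_eq_mul,
      mul_comm]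
  have hKturn : ∫ θ in φ 0..φ T, K θ = ε * (2 * π * sk r ctr rad k) := by
    rw [hturn]
    rcases hε' with h | h <;> rw [h]
    · simpa using hKint (φ 0)
    · rw [intervalIntegral.integral_symm]
      have h := hKint (φ 0 + ((-1 : ℤ) : ℝ) * (2 * π))
      rw [show φ 0 + ((-1 : ℤ) : ℝ) * (2 * π) + 2 * π = φ 0 by push_cast; ring] at h
      rw [h]
      push_cast
      ring
  have hsubst : ∫ s in (0 : ℝ)..T, K (φ s) * ω (γ s) = ∫ θ in φ 0..φ T, K θ :=
    intervalIntegral.integral_comp_mul_deriv (fun t _ => hφ t)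
      (hωcont.comp hγcont).continuousOn hKcont
  -- the rest is the derivative of a periodic function
  set L : ℝ → ℝ := fun t => (1 - 1 / τ k) * Real.log (pev (Bpoly r ctr) (γ t)) -
    ∑ j ∈ Finset.univ.erase k, (τ j / τ k - 1) * Real.log (pev (fk ctr rad j) (γ t)) with hL
  set div : ℝ → ℝ := fun t => pev (divPoly (PT r ctr rad τ) (QT r ctr rad τ)) (γ t) with hdiv
  have hLderiv : ∀ t, HasDerivAt L (div t - 2 / τ k * (K (φ t) * ω (γ t))) t := by
    intro t
    have h1 := ((hasDerivAt_pev (Bpoly r ctr) (hγ1 t) (hγ2 t)).log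
      (hB _ (hmem t)).ne').const_mul (1 - 1 / τ k)
    have h2 := HasDerivAt.fun_sum (u := Finset.univ.erase k) fun j hj =>
      ((hasDerivAt_pev (fk ctr rad j) (hγ1 t) (hγ2 t)).log
        (hne _ (hmem t) j (Finset.ne_of_mem_erase hj))).const_mul (τ j / τ k - 1)
    refine (h1.sub h2).congr_deriv ?_
    have hb := (hB _ (hmem t)).ne'
    have hlog : ∀ i, pev (pderiv i (Bpoly r ctr)) (γ t) / pev (Bpoly r ctr) (γ t)
        = ∑ j ∈ S, pev (pderiv i (gpoly (ctr j))) (γ t) / pev (gpoly (ctr j)) (γ t) := by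
      intro i
      rw [Bpoly, pev_pderiv_prod _ _ _ _ fun j _ => (hg _ (hmem t) j).ne', ← Bpoly,
        mul_div_cancel_left₀ _ hb]
    have hKt : ((γ t).1 - (ctr k).1) *
          (pev (pderiv 0 (Bpoly r ctr)) (γ t) / pev (Bpoly r ctr) (γ t)) +
        ((γ t).2 - (ctr k).2) *
          (pev (pderiv 1 (Bpoly r ctr)) (γ t) / pev (Bpoly r ctr) (γ t)) = 2 * K (φ t) := by
      rw [hlog, hlog, Finset.mul_sum, Finset.mul_sum, ← Finset.sum_add_distrib, hK,
        Finset.mul_sum]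
      refine Finset.sum_congr rfl fun j _ => ?_
      rw [pev_pderiv_zero_gpoly, pev_pderiv_one_gpoly, hγpt t]
      simp only [hκ, ← hgpt]
      simp only [hpt]
      ring
    simp only [hdiv]
    rw [pev_divPoly (hmem t) (hne _ (hmem t)) hb hτk, hKt]
    simp only [hω]
    field_simp
    ring
  have hdivcont : Continuous div := (continuous_pev _).comp hγcont
  have hKωcont : Continuous fun t => 2 / τ k * (K (φ t) * ω (γ t)) :=
    continuous_const.mul ((hKcont.comp (continuous_iff_continuousAt.2
      fun t => (hφ t).continuousAt)).mul (hωcont.comp hγcont))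
  have hzero : ∫ t in (0 : ℝ)..T, (div t - 2 / τ k * (K (φ t) * ω (γ t))) = 0 := by
    rw [intervalIntegral.integral_eq_sub_of_hasDerivAt (fun t _ => hLderiv t)
      ((hdivcont.sub hKωcont).intervalIntegrable _ _)]
    simp only [hL, show γ T = γ 0 by simpa using hperiod 0, sub_self]
  rw [intervalIntegral.integral_sub (hdivcont.intervalIntegrable _ _)
    (hKωcont.intervalIntegrable _ _), intervalIntegral.integral_const_mul, hsubst, hKturn,
    hεcast, sub_eq_zero] at hzero
  rw [hzero]
  ring
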